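/- Under hypotheses (H0)-(H4), for every q ∈ ℝ^{d−1}×(0,∞), the point γ_q is the unique minimizer over γ ∈ ℝ^{d−1}×{0} of the function γ ↦ I(0,γ) + I⁺(γ,q) = sup_{a∈D̂} a·γ + sup_{a∈D} a·(q−γ). -/

import Mathlib

open scoped ENNReal
open Filter MeasureTheory

namespace ReflectedRW

/-- `ℤ^d` realized as `ℤ^{d-1} × ℤ`. -/
abbrev Zd (d : ℕ) := (Fin (d-1) → ℤ) × ℤ
/-- `ℝ^d` realized as `ℝ^{d-1} × ℝ`. -/
abbrev Rd (d : ℕ) := (Fin (d-1) → ℝ) × ℝ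
/-- The state space `ℤ^{d-1} × ℕ` of the reflected walk. -/
abbrev St (d : ℕ) := (Fin (d-1) → ℤ) × ℕ

/-- Embedding of the state space into `ℤ^d`. -/
def toZ (d : ℕ) (z : St d) : Zd d := (z.1, (z.2 : ℤ))

/-- Embedding of `ℤ^d` into `ℝ^d`. -/
def toR (d : ℕ) (z : Zd d) : Rd d := (fun i => (z.1 i : ℝ), (z.2 : ℝ))

/-- Scalar product `a · z` of `a ∈ ℝ^d` and `z ∈ ℤ^d`. -/
noncomputable def dotZ (d : ℕ) (a : Rd d) (z : Zd d) : ℝ :=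
  (∑ i, a.1 i * (z.1 i : ℝ)) + a.2 * (z.2 : ℝ)

/-- Scalar product on `ℝ^d`. -/
noncomputable def dotR (d : ℕ) (a q : Rd d) : ℝ :=
  (∑ i, a.1 i * q.1 i) + a.2 * q.2

/-- One-step transition probabilities of the reflected random walk `Z(t)`:
jumps with law `μ` in the interior and with law `μ0` on the boundary `y = 0`. -/
noncomputable def step (d : ℕ) (μ μ0 : Zd d → ℝ) (z z' : St d) : ℝ≥0∞ :=
  if z.2 = 0 then ENNReal.ofReal (μ0 (toZ d z' - toZ d z))
  else ENNReal.ofReal (μ (toZ d z' - toZ d z))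

/-- Real-valued version of the transition kernel of `Z(t)`. -/
noncomputable def stepR (d : ℕ) (μ μ0 : Zd d → ℝ) (z z' : St d) : ℝ :=
  if z.2 = 0 then μ0 (toZ d z' - toZ d z) else μ (toZ d z' - toZ d z)

/-- `n`-step kernel obtained by iterating a sub-Markov kernel `p`. -/
noncomputable def kerIter {S : Type*} [DecidableEq S] (p : S → S → ℝ≥0∞) :
    ℕ → S → S → ℝ≥0∞
  | 0, z, z' => if z = z' then 1 else 0
  | n+1, z, z' => ∑' w : S, kerIter p n z w * p w z'

/-- `n`-step transition probabilities of `Z(t)`: `P_z(Z(n) = z')`. -/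
noncomputable def stepn (d : ℕ) (μ μ0 : Zd d → ℝ) : ℕ → St d → St d → ℝ≥0∞ :=
  kerIter (step d μ μ0)

/-- Green's function `G(z,z') = ∑_{t ≥ 0} P_z(Z(t) = z')` of the reflected walk. -/
noncomputable def green (d : ℕ) (μ μ0 : Zd d → ℝ) (z z' : St d) : ℝ≥0∞ :=
  ∑' n : ℕ, stepn d μ μ0 n z z'

/-- Kernel of the walk killed upon hitting the boundary hyperplane `y = 0`. -/
noncomputable def stepKilled (d : ℕ) (μ μ0 : Zd d → ℝ) (z z' : St d) : ℝ≥0∞ :=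
  if z'.2 = 0 then 0 else step d μ μ0 z z'

/-- `n`-step kernel of the killed walk: `P_z(Z(n) = z', τ > n)` where
`τ` is the first return time to the boundary hyperplane. -/
noncomputable def stepKilledn (d : ℕ) (μ μ0 : Zd d → ℝ) : ℕ → St d → St d → ℝ≥0∞ :=
  kerIter (stepKilled d μ μ0)

/-- Green's function `G₊(z,z')` of the killed walk. -/
noncomputable def greenPlus (d : ℕ) (μ μ0 : Zd d → ℝ) (z z' : St d) : ℝ≥0∞ :=
  ∑' n : ℕ, stepKilledn d μ μ0 n z z'

/-- One-step kernel of the homogeneous random walk `S(t)` on `ℤ^d`. -/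
noncomputable def stepS (d : ℕ) (μ : Zd d → ℝ) (z z' : Zd d) : ℝ≥0∞ :=
  ENNReal.ofReal (μ (z' - z))

/-- `n`-step kernel of the homogeneous random walk on `ℤ^d`. -/
noncomputable def stepSn (d : ℕ) (μ : Zd d → ℝ) : ℕ → Zd d → Zd d → ℝ≥0∞ :=
  kerIter (stepS d μ)

/-- Green's function `G_S` of the homogeneous random walk on `ℤ^d`. -/
noncomputable def greenS (d : ℕ) (μ : Zd d → ℝ) (z z' : Zd d) : ℝ≥0∞ :=
  ∑' n : ℕ, stepSn d μ n z z'

/-- `hitProb z w = P_z(τ < ∞, Z(τ) = w)`, the hitting distribution on the boundary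
hyperplane, `τ = inf{t ≥ 1 : Z(t) ∈ ℤ^{d-1}×{0}}`. -/
noncomputable def hitProb (d : ℕ) (μ μ0 : Zd d → ℝ) (z w : St d) : ℝ≥0∞ :=
  if w.2 = 0 then
    ∑' n : ℕ, ∑' v : St d, stepKilledn d μ μ0 n z v * step d μ μ0 v w
  else 0

/-- The jump generating function `φ(a) = ∑_z μ(z) e^{a·z}`. -/
noncomputable def jgf (d : ℕ) (μ : Zd d → ℝ) (a : Rd d) : ℝ :=
  ∑' z : Zd d, μ z * Real.exp (dotZ d a z)

/-- Partial derivative `∂φ/∂β` of the jump generating function in the last coordinate. -/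
noncomputable def jgfDβ (d : ℕ) (μ : Zd d → ℝ) (a : Rd d) : ℝ :=
  ∑' z : Zd d, μ z * (z.2 : ℝ) * Real.exp (dotZ d a z)

/-- Gradient `∇φ(a)` of the jump generating function. -/
noncomputable def jgfGrad (d : ℕ) (μ : Zd d → ℝ) (a : Rd d) : Rd d :=
  (fun i => ∑' z : Zd d, μ z * (z.1 i : ℝ) * Real.exp (dotZ d a z), jgfDβ d μ a)

/-- The set `D = {a : φ(a) ≤ 1}`. -/
def Dset (d : ℕ) (μ : Zd d → ℝ) : Set (Rd d) := {a | jgf d μ a ≤ 1}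

/-- `∂₊D`: points of the boundary of `D` where the last coordinate of `∇φ` is `≥ 0`. -/
def bdPlus (d : ℕ) (μ : Zd d → ℝ) : Set (Rd d) :=
  {a | jgf d μ a = 1 ∧ 0 ≤ jgfDβ d μ a}

/-- `∂₋D`: points of the boundary of `D` where the last coordinate of `∇φ` is `≤ 0`. -/
def bdMinus (d : ℕ) (μ : Zd d → ℝ) : Set (Rd d) :=
  {a | jgf d μ a = 1 ∧ jgfDβ d μ a ≤ 0}

/-- `∂₀D`: points of the boundary of `D` where the last coordinate of `∇φ` is `0`. -/
def bdZero (d : ℕ) (μ : Zd d → ℝ) : Set (Rd d) :=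
  {a | jgf d μ a = 1 ∧ jgfDβ d μ a = 0}

/-- `Θ = {α ∈ ℝ^{d-1} : inf_β max(φ(α,β), φ₀(α,β)) ≤ 1}`. -/
noncomputable def Theta (d : ℕ) (μ μ0 : Zd d → ℝ) : Set (Fin (d-1) → ℝ) :=
  {α | (⨅ β : ℝ, max (jgf d μ (α, β)) (jgf d μ0 (α, β))) ≤ 1}

/-- `D̂ = (Θ×ℝ) ∩ D`. -/
noncomputable def Dhat (d : ℕ) (μ μ0 : Zd d → ℝ) : Set (Rd d) :=
  {a | a.1 ∈ Theta d μ μ0 ∧ jgf d μ a ≤ 1}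

/-- Normal cone to a convex set `s ⊆ ℝ^d` at the point `a`. -/
noncomputable def normalCone (d : ℕ) (s : Set (Rd d)) (a : Rd d) : Set (Rd d) :=
  {q | ∀ b ∈ s, dotR d q (b - a) ≤ 0}

/-- The mean vector `m = ∑_z z μ(z)`. -/
noncomputable def meanVec (d : ℕ) (μ : Zd d → ℝ) : Rd d :=
  (fun i => ∑' z : Zd d, μ z * (z.1 i : ℝ), ∑' z : Zd d, μ z * (z.2 : ℝ))

/-- The harmonic functions `h_a` of (1-8), for `a ∈ D̂ ∩ ∂₊D` with associated
point `abar = ā ∈ ∂₋D` (same first `d-1` coordinates as `a`). -/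
noncomputable def hfun (d : ℕ) (μ μ0 : Zd d → ℝ) (a abar : Rd d) (z : St d) : ℝ :=
  if jgf d μ0 abar = 1 then Real.exp (dotZ d abar (toZ d z))
  else if a = abar then
    (z.2 : ℝ) * Real.exp (dotZ d a (toZ d z))
      + (jgfDβ d μ0 a / (1 - jgf d μ0 a)) * Real.exp (dotZ d a (toZ d z))
  else
    Real.exp (dotZ d a (toZ d z))
      - ((1 - jgf d μ0 a) / (1 - jgf d μ0 abar)) * Real.exp (dotZ d abar (toZ d z))

/-- `h : ℤ^{d-1}×ℕ → ℝ` is harmonic for the reflected walk. -/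
def IsHarmonic (d : ℕ) (μ μ0 : Zd d → ℝ) (h : St d → ℝ) : Prop :=
  ∀ z : St d, HasSum (fun z' => stepR d μ μ0 z z' * h z') (h z)

/-- Minimal nonnegative harmonic function. -/
def IsMinimalHarmonic (d : ℕ) (μ μ0 : Zd d → ℝ) (h : St d → ℝ) : Prop :=
  IsHarmonic d μ μ0 h ∧ (∀ z, 0 ≤ h z) ∧ h ≠ 0 ∧
    ∀ h' : St d → ℝ, IsHarmonic d μ μ0 h' → (∀ z, 0 ≤ h' z) → h' ≠ 0 →
      (∀ z, h' z ≤ h z) → ∃ c : ℝ, 0 < c ∧ h' = fun z => c * h z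

/- Hypotheses (H0)–(H4). -/

/-- `(H0)`: `μ(x,y) = 0` for `y < -1` and `μ₀(x,y) = 0` for `y < 0`. -/
def H0 (d : ℕ) (μ μ0 : Zd d → ℝ) : Prop :=
  (∀ z : Zd d, z.2 < -1 → μ z = 0) ∧ (∀ z : Zd d, z.2 < 0 → μ0 z = 0)

/-- `(H1)`: the reflected walk is irreducible on `ℤ^{d-1}×ℕ`. -/
def H1 (d : ℕ) (μ μ0 : Zd d → ℝ) : Prop :=
  ∀ z z' : St d, ∃ n : ℕ, 0 < stepn d μ μ0 n z z'

/-- `(H2)`: the homogeneous walk with step law `μ` is irreducible on `ℤ^d` and its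
last coordinate is an aperiodic random walk on `ℤ`. -/
def H2 (d : ℕ) (μ : Zd d → ℝ) : Prop :=
  (∀ z z' : Zd d, ∃ n : ℕ, 0 < stepSn d μ n z z') ∧
    AddSubgroup.closure {y : ℤ | ∃ x : Fin (d-1) → ℤ, μ (x, y) ≠ 0} = ⊤

/-- `(H3)`: `m ≠ 0` and `m/|m| + m₀/|m₀| ≠ 0`. -/
noncomputable def H3 (d : ℕ) (μ μ0 : Zd d → ℝ) : Prop :=
  meanVec d μ ≠ 0 ∧ meanVec d μ0 ≠ 0 ∧
    ‖meanVec d μ‖⁻¹ • meanVec d μ + ‖meanVec d μ0‖⁻¹ • meanVec d μ0 ≠ 0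

/-- `(H4)`: the jump generating functions are finite everywhere on `ℝ^d`. -/
def H4 (d : ℕ) (μ μ0 : Zd d → ℝ) : Prop :=
  ∀ a : Rd d, Summable (fun z : Zd d => μ z * Real.exp (dotZ d a z)) ∧
    Summable (fun z : Zd d => μ0 z * Real.exp (dotZ d a z))

/-- `μ` is a probability distribution on `ℤ^d`. -/
def IsProb (d : ℕ) (μ : Zd d → ℝ) : Prop :=
  (∀ z : Zd d, 0 ≤ μ z) ∧ HasSum μ 1


section BilinearForms

variable {d : ℕ}

lemma dotZ_add (a b : Rd d) (z : Zd d) : dotZ d (a + b) z = dotZ d a z + dotZ d b z := by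
  simp only [dotZ, Prod.fst_add, Prod.snd_add, Pi.add_apply, add_mul, Finset.sum_add_distrib]
  ring

lemma dotZ_smul (t : ℝ) (a : Rd d) (z : Zd d) : dotZ d (t • a) z = t * dotZ d a z := by
  simp only [dotZ, Prod.smul_fst, Prod.smul_snd, Pi.smul_apply, smul_eq_mul, mul_assoc,
    mul_add, Finset.mul_sum]

lemma dotZ_zero_left (z : Zd d) : dotZ d 0 z = 0 := by
  simp [dotZ]

lemma dotZ_sub_right (a : Rd d) (z w : Zd d) : dotZ d a (z - w) = dotZ d a z - dotZ d a w := by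
  simp only [dotZ, Prod.fst_sub, Prod.snd_sub, Pi.sub_apply, Int.cast_sub, mul_sub,
    Finset.sum_sub_distrib]
  ring

lemma dotR_comm (a b : Rd d) : dotR d a b = dotR d b a := by
  simp only [dotR, mul_comm]

lemma dotR_add_right (v a b : Rd d) : dotR d v (a + b) = dotR d v a + dotR d v b := by
  simp only [dotR, Prod.fst_add, Prod.snd_add, Pi.add_apply, mul_add, Finset.sum_add_distrib]
  ring

lemma dotR_smul_right (t : ℝ) (v a : Rd d) : dotR d v (t • a) = t * dotR d v a := by
  simp only [dotR, Prod.smul_fst, Prod.smul_snd, Pi.smul_apply, smul_eq_mul, mul_left_comm,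
    mul_add, Finset.mul_sum]

lemma dotR_sub_right (v a b : Rd d) : dotR d v (a - b) = dotR d v a - dotR d v b := by
  simp only [dotR, Prod.fst_sub, Prod.snd_sub, Pi.sub_apply, mul_sub, Finset.sum_sub_distrib]
  ring

lemma eq_of_dotR_eq {v w : Rd d} (h : ∀ u, dotR d v u = dotR d w u) : v = w := by
  refine Prod.ext (funext fun i => ?_) ?_
  · simpa [dotR, Pi.single_apply] using h (Pi.single i 1, 0)
  · simpa [dotR] using h (0, 1)

end BilinearForms

section Derivative

/-- Under exponential moments of all orders, a Laplace transform of a nonnegative family can be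
differentiated termwise at the origin. -/
lemma hasDerivAt_tsum_mul_exp {ι : Type*} {c x : ι → ℝ} (hc : ∀ i, 0 ≤ c i)
    (h : ∀ t : ℝ, Summable fun i => c i * Real.exp (t * x i)) :
    (Summable fun i => c i * x i) ∧
      HasDerivAt (fun t : ℝ => ∑' i, c i * Real.exp (t * x i)) (∑' i, c i * x i) 0 := by
  have hu := (h 2).add (h (-2))
  have hb : ∀ i (t : ℝ), t ∈ Metric.ball (0 : ℝ) 1 →
      ‖c i * x i * Real.exp (t * x i)‖ ≤
        c i * Real.exp (2 * x i) + c i * Real.exp (-2 * x i) := by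
    intro i t ht
    have ht : |t| < 1 := by simpa using ht
    have h1 : |x i| ≤ Real.exp |x i| := by linarith [Real.add_one_le_exp |x i|]
    have h2 : Real.exp (t * x i) ≤ Real.exp |x i| := by
      refine Real.exp_le_exp.2 ((le_abs_self _).trans ?_)
      rw [abs_mul]
      exact mul_le_of_le_one_left (abs_nonneg _) ht.le
    have h3 : Real.exp |x i| * Real.exp |x i| ≤
        Real.exp (2 * x i) + Real.exp (-2 * x i) := by
      rw [← Real.exp_add, ← two_mul]
      rcases abs_cases (x i) with ⟨e, -⟩ | ⟨e, -⟩ <;> rw [e]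
      · linarith [Real.exp_pos (-2 * x i)]
      · rw [show 2 * -x i = -2 * x i by ring]
        linarith [Real.exp_pos (2 * x i)]
    rw [Real.norm_eq_abs, abs_mul, abs_mul, abs_of_nonneg (hc i), Real.abs_exp, mul_assoc,
      ← mul_add]
    exact mul_le_mul_of_nonneg_left
      ((mul_le_mul h1 h2 (Real.exp_pos _).le (Real.exp_pos _).le).trans h3) (hc i)
  have h0 : (0 : ℝ) ∈ Metric.ball (0 : ℝ) 1 := by simp
  refine ⟨Summable.of_norm_bounded hu fun i => by simpa using hb i 0 h0, ?_⟩
  have := hasDerivAt_tsum_of_isPreconnected (g := fun i (t : ℝ) => c i * Real.exp (t * x i))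
    (g' := fun i (t : ℝ) => c i * x i * Real.exp (t * x i)) hu Metric.isOpen_ball
    (convex_ball (0 : ℝ) 1).isPreconnected
    (fun i t _ => by
      have := (((hasDerivAt_id t).mul_const (x i)).exp).const_mul (c i)
      simp only [id, one_mul] at this
      rw [mul_assoc, mul_comm (x i)]
      exact this)
    hb h0 (h 0) h0
  simpa using this

/-- A function with negative derivative takes smaller values just to the right. -/
lemma exists_pos_lt_of_hasDerivAt_neg {f : ℝ → ℝ} {f' : ℝ} (h : HasDerivAt f f' 0)
    (hf' : f' < 0) : ∃ t > 0, f t < f 0 := by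
  have h1 := (hasDerivAt_iff_tendsto_slope.1 h).eventually (gt_mem_nhds hf')
  have h2 := h1.filter_mono (nhdsGT_le_nhdsNE 0)
  obtain ⟨t, ht, htpos⟩ := (h2.and self_mem_nhdsWithin).exists
  refine ⟨t, htpos, ?_⟩
  rw [slope_def_field, sub_zero, div_neg_iff] at ht
  rcases ht with ht | ht <;> linarith

end Derivative

section GeneratingFunction

variable {d : ℕ} {μ : Zd d → ℝ}

/-- Directional derivative of the jump generating function at `a` in the direction `w`. -/
noncomputable def jgfDir (d : ℕ) (μ : Zd d → ℝ) (a w : Rd d) : ℝ :=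
  ∑' z : Zd d, μ z * Real.exp (dotZ d a z) * dotZ d w z

lemma jgfDir_spec (hμ : ∀ z, 0 ≤ μ z)
    (hs : ∀ a : Rd d, Summable fun z : Zd d => μ z * Real.exp (dotZ d a z)) (a w : Rd d) :
    (Summable fun z : Zd d => μ z * Real.exp (dotZ d a z) * dotZ d w z) ∧
      HasDerivAt (fun t : ℝ => jgf d μ (a + t • w)) (jgfDir d μ a w) 0 := by
  have e : ∀ (t : ℝ) (z : Zd d), μ z * Real.exp (dotZ d (a + t • w) z) =
      μ z * Real.exp (dotZ d a z) * Real.exp (t * dotZ d w z) := by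
    intro t z
    rw [dotZ_add, dotZ_smul, Real.exp_add, mul_assoc]
  have := hasDerivAt_tsum_mul_exp (c := fun z : Zd d => μ z * Real.exp (dotZ d a z))
    (x := fun z => dotZ d w z) (fun z => mul_nonneg (hμ z) (Real.exp_pos _).le)
    (fun t => (hs (a + t • w)).congr fun z => e t z)
  simpa only [jgf, jgfDir, e] using this

lemma jgfDir_add_smul (hμ : ∀ z, 0 ≤ μ z)
    (hs : ∀ a : Rd d, Summable fun z : Zd d => μ z * Real.exp (dotZ d a z)) (a w u : Rd d)
    (t : ℝ) : jgfDir d μ a (w + t • u) = jgfDir d μ a w + t * jgfDir d μ a u := by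
  have hw := (jgfDir_spec hμ hs a w).1
  have hu := (jgfDir_spec hμ hs a u).1
  rw [jgfDir, jgfDir, jgfDir, ← tsum_mul_left, ← hw.tsum_add (hu.mul_left t)]
  refine tsum_congr fun z => ?_
  rw [dotZ_add, dotZ_smul]
  ring

lemma exists_pos_jgf_lt (hμ : ∀ z, 0 ≤ μ z)
    (hs : ∀ a : Rd d, Summable fun z : Zd d => μ z * Real.exp (dotZ d a z)) {a w : Rd d}
    (h : jgfDir d μ a w < 0) : ∃ t : ℝ, 0 < t ∧ jgf d μ (a + t • w) < jgf d μ a := by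
  obtain ⟨t, ht, hlt⟩ := exists_pos_lt_of_hasDerivAt_neg (jgfDir_spec hμ hs a w).2 h
  exact ⟨t, ht, by simpa using hlt⟩

/-- The tangent inequality for the convex function `jgf`. -/
lemma jgfDir_sub_le (hμ : ∀ z, 0 ≤ μ z)
    (hs : ∀ a : Rd d, Summable fun z : Zd d => μ z * Real.exp (dotZ d a z)) (a b : Rd d) :
    jgfDir d μ a (b - a) ≤ jgf d μ b - jgf d μ a := by
  rw [jgf, jgf, ← (hs b).tsum_sub (hs a)]
  refine (jgfDir_spec hμ hs a (b - a)).1.tsum_le_tsum (fun z => ?_) ((hs b).sub (hs a))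
  have e : dotZ d b z = dotZ d a z + dotZ d (b - a) z := by rw [← dotZ_add, add_sub_cancel]
  rw [e, Real.exp_add, ← mul_assoc]
  have := mul_le_mul_of_nonneg_left (Real.add_one_le_exp (dotZ d (b - a) z))
    (mul_nonneg (hμ z) (Real.exp_pos (dotZ d a z)).le)
  linarith

/-- A walk with nonzero drift has `jgf < 1` somewhere. -/
lemma exists_jgf_lt_one (hμ : IsProb d μ)
    (hs : ∀ a : Rd d, Summable fun z : Zd d => μ z * Real.exp (dotZ d a z))
    (hm : meanVec d μ ≠ 0) : ∃ p : Rd d, jgf d μ p < 1 := by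
  have h0 : jgf d μ 0 = 1 := by simp [jgf, dotZ_zero_left, hμ.2.tsum_eq]
  have key : ∀ w : Rd d, jgfDir d μ 0 w ≠ 0 → ∃ p : Rd d, jgf d μ p < 1 := by
    intro w hw
    have hneg : jgfDir d μ 0 (0 + (-jgfDir d μ 0 w) • w) < 0 := by
      rw [jgfDir_add_smul hμ.1 hs]
      have : jgfDir d μ 0 0 = 0 := by simp [jgfDir, dotZ_zero_left]
      rw [this]
      nlinarith [mul_self_pos.2 hw]
    obtain ⟨t, -, h⟩ := exists_pos_jgf_lt hμ.1 hs hneg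
    exact ⟨_, h0 ▸ h⟩
  by_contra hcon
  have key' : ∀ w : Rd d, jgfDir d μ 0 w = 0 := fun w => by
    by_contra hw
    exact hcon (key w hw)
  refine hm (Prod.ext (funext fun i => ?_) ?_)
  · simpa [jgfDir, dotZ, Pi.single_apply, meanVec] using key' (Pi.single i 1, 0)
  · simpa [jgfDir, dotZ, meanVec] using key' (0, 1)

/-- The normal cone to `D` at a boundary point is contained in the line spanned by the gradient, so
its elements are determined by a positive last coordinate. -/
lemma eq_of_mem_normalCone_Dset (hμ : IsProb d μ)
    (hs : ∀ a : Rd d, Summable fun z : Zd d => μ z * Real.exp (dotZ d a z))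
    (hm : meanVec d μ ≠ 0) {a v w : Rd d} (ha : jgf d μ a = 1)
    (hv : v ∈ normalCone d (Dset d μ) a) (hw : w ∈ normalCone d (Dset d μ) a)
    (hvw : v.2 = w.2) (hpos : 0 < v.2) : v = w := by
  obtain ⟨p, hp⟩ := exists_jgf_lt_one hμ hs hm
  set u := p - a
  set g := jgfDir d μ a
  have hgu : g u < 0 := (jgfDir_sub_le hμ.1 hs a p).trans_lt (by linarith)
  have hlin : ∀ x y t, g (x + t • y) = g x + t * g y := jgfDir_add_smul hμ.1 hs a
  have hneg : ∀ v ∈ normalCone d (Dset d μ) a, ∀ x, g x < 0 → dotR d v x ≤ 0 := by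
    intro v hv x hx
    obtain ⟨t, ht, hlt⟩ := exists_pos_jgf_lt hμ.1 hs hx
    have := hv (a + t • x) (by rw [Dset, Set.mem_ofPred_eq]; linarith)
    rw [add_sub_cancel_left, dotR_smul_right] at this
    exact nonpos_of_mul_nonpos_right this ht
  have hker : ∀ v ∈ normalCone d (Dset d μ) a, ∀ x, g x = 0 → dotR d v x ≤ 0 := by
    intro v hv x hx
    by_contra! hvx
    have hvu : ∀ ε > 0, dotR d v x + ε * dotR d v u ≤ 0 := by
      intro ε hε
      have := hneg v hv (x + ε • u) (by rw [hlin, hx]; nlinarith)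
      rwa [dotR_add_right, dotR_smul_right] at this
    have h1 := hvu (dotR d v x / (2 * (|dotR d v u| + 1))) (by positivity)
    have h2 : dotR d v x / (2 * (|dotR d v u| + 1)) * (2 * (|dotR d v u| + 1)) = dotR d v x :=
      div_mul_cancel₀ _ (by positivity)
    have h3 : 0 < dotR d v x / (2 * (|dotR d v u| + 1)) := by positivity
    nlinarith [neg_abs_le (dotR d v u), abs_nonneg (dotR d v u)]
  have hprop : ∀ v ∈ normalCone d (Dset d μ) a, ∀ x, dotR d v x = g x / g u * dotR d v u := by
    intro v hv x
    have h1 := hker v hv (x + (-(g x / g u)) • u) (by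
      rw [hlin, neg_mul, div_mul_cancel₀ _ hgu.ne, add_neg_cancel])
    have h0 : g 0 = 0 := by simp [g, jgfDir, dotZ_zero_left]
    have h2 := hker v hv ((0 + (-1 : ℝ) • x) + (g x / g u) • u) (by
      rw [hlin, hlin, h0, div_mul_cancel₀ _ hgu.ne]; ring)
    simp only [dotR_add_right, dotR_smul_right] at h1 h2
    have h3 : dotR d v 0 = 0 := by simp [dotR]
    linarith
  have hlast : ∀ v : Rd d, dotR d v (0, 1) = v.2 := fun v => by simp [dotR]
  have hv1 := hprop v hv (0, 1)
  have hw1 := hprop w hw (0, 1)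
  rw [hlast] at hv1 hw1
  have hne : g (0, 1) / g u ≠ 0 := by
    intro h
    rw [h, zero_mul] at hv1
    linarith
  have huu : dotR d v u = dotR d w u := mul_left_cancel₀ hne (by rw [← hv1, ← hw1, hvw])
  exact eq_of_dotR_eq fun x => by rw [hprop v hv, hprop w hw, huu]

end GeneratingFunction

section Boundedness

variable {d : ℕ} {μ : Zd d → ℝ}

lemma exists_dotZ_le_of_stepSn_pos (hμ : ∀ z, 0 ≤ μ z)
    (hs : ∀ a : Rd d, Summable fun z : Zd d => μ z * Real.exp (dotZ d a z)) (n : ℕ)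
    (z z' : Zd d) (h : 0 < stepSn d μ n z z') :
    ∃ C : ℝ, ∀ a ∈ Dset d μ, dotZ d a (z' - z) ≤ C := by
  induction n generalizing z' with
  | zero =>
    have hz : z = z' := by
      by_contra hne
      simp [stepSn, kerIter, hne] at h
    exact ⟨0, fun a _ => by simp [hz, dotZ]⟩
  | succ n ih =>
    obtain ⟨w, hw⟩ : ∃ w, kerIter (stepS d μ) n z w * stepS d μ w z' ≠ 0 := by
      by_contra! hcon
      exact h.ne' (ENNReal.tsum_eq_zero.2 hcon)
    obtain ⟨h1, h2⟩ := mul_ne_zero_iff.1 hw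
    obtain ⟨C, hC⟩ := ih w (pos_iff_ne_zero.2 h1)
    have hpos : 0 < μ (z' - w) := ENNReal.ofReal_pos.1 (pos_iff_ne_zero.2 h2)
    refine ⟨C - Real.log (μ (z' - w)), fun a ha => ?_⟩
    have hle : μ (z' - w) * Real.exp (dotZ d a (z' - w)) ≤ 1 :=
      ((hs a).le_tsum (z' - w) fun z _ => mul_nonneg (hμ z) (Real.exp_pos _).le).trans ha
    have hlog := Real.log_nonpos (mul_pos hpos (Real.exp_pos _)).le hle
    rw [Real.log_mul hpos.ne' (Real.exp_pos _).ne', Real.log_exp] at hlog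
    have := hC a ha
    rw [dotZ_sub_right] at this hlog ⊢
    linarith

/-- Irreducibility of the homogeneous walk makes `D` bounded in every direction. -/
lemma bddAbove_dotR_Dset (hμ : ∀ z, 0 ≤ μ z)
    (hs : ∀ a : Rd d, Summable fun z : Zd d => μ z * Real.exp (dotZ d a z))
    (hirr : ∀ z z' : Zd d, ∃ n : ℕ, 0 < stepSn d μ n z z') (v : Rd d) :
    ∃ C : ℝ, ∀ a ∈ Dset d μ, dotR d a v ≤ C := by
  have hZ : ∀ z : Zd d, ∃ C : ℝ, ∀ a ∈ Dset d μ, dotZ d a z ≤ C := fun z => by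
    obtain ⟨n, hn⟩ := hirr 0 z
    simpa using exists_dotZ_le_of_stepSn_pos hμ hs n 0 z hn
  have hmul : ∀ z : Zd d, ∀ r : ℝ, ∃ C : ℝ, ∀ a ∈ Dset d μ, dotZ d a z * r ≤ C := by
    intro z r
    obtain ⟨C, hC⟩ := hZ z
    obtain ⟨C', hC'⟩ := hZ (0 - z)
    refine ⟨max (C * r) (-C' * r), fun a ha => ?_⟩
    have h1 := hC a ha
    have h2 := hC' a ha
    rw [dotZ_sub_right, show dotZ d a 0 = 0 by simp [dotZ]] at h2
    rcases le_total 0 r with hr | hr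
    · exact le_max_of_le_left (mul_le_mul_of_nonneg_right h1 hr)
    · exact le_max_of_le_right (mul_le_mul_of_nonpos_right (by linarith) hr)
  choose C hC using fun i => hmul (Pi.single i 1, 0) (v.1 i)
  obtain ⟨C', hC'⟩ := hmul (0, 1) v.2
  refine ⟨(∑ i, C i) + C', fun a ha => add_le_add (Finset.sum_le_sum fun i _ => ?_) ?_⟩
  · simpa [dotZ, Pi.single_apply] using hC i a ha
  · simpa [dotZ] using hC' a ha

end Boundedness

/-- Elements of the normal cone are the directions whose linear form is maximal at the point. -/
lemma mem_normalCone_iff {d : ℕ} {s : Set (Rd d)} {a v : Rd d} :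
    v ∈ normalCone d s a ↔ ∀ b ∈ s, dotR d b v ≤ dotR d a v := by
  simp only [normalCone, Set.mem_ofPred_eq, dotR_sub_right, sub_nonpos, dotR_comm v]

lemma iSup_dotR_eq {d : ℕ} {s : Set (Rd d)} {a v : Rd d} (ha : a ∈ s)
    (hv : v ∈ normalCone d s a) : (⨆ b : ↥s, dotR d (b : Rd d) v) = dotR d a v := by
  have h := mem_normalCone_iff.1 hv
  have : Nonempty ↥s := ⟨⟨a, ha⟩⟩
  refine le_antisymm (ciSup_le fun b => h b b.2) ?_
  exact le_ciSup (f := fun b : ↥s => dotR d (b : Rd d) v)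
    ⟨dotR d a v, by rintro _ ⟨b, rfl⟩; exact h b b.2⟩ ⟨a, ha⟩

/-- `γ_q` is the unique minimizer over `γ ∈ ℝ^{d-1}×{0}` of
`γ ↦ I(0,γ) + I⁺(γ,q) = sup_{a∈D̂} a·γ + sup_{a∈D} a·(q-γ)`. -/
theorem gamma_unique_minimizer
    (d : ℕ) (hd : 2 ≤ d) (μ μ0 : Zd d → ℝ)
    (hμ : IsProb d μ) (hμ0 : IsProb d μ0)
    (hH0 : H0 d μ μ0) (hH1 : H1 d μ μ0) (hH2 : H2 d μ)
    (hH3 : H3 d μ μ0) (hH4 : H4 d μ μ0)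
    (q : Rd d) (hq : 0 < q.2)
    (ahat : Rd d)
    (hahat : ahat ∈ Dhat d μ μ0 ∧ ahat ∈ bdPlus d μ ∧
      q ∈ normalCone d (Dhat d μ μ0) ahat)
    (γq : Rd d)
    (hγq : γq.2 = 0 ∧ (q - γq) ∈ normalCone d (Dset d μ) ahat ∧
      γq ∈ normalCone d (Dhat d μ μ0) ahat ∧
      (q - γq) ∈ normalCone d (Dhat d μ μ0) ahat) :
    ∀ γ : Rd d, γ.2 = 0 →
      (((⨆ a : ↥(Dhat d μ μ0), dotR d (a : Rd d) γq) +
          ⨆ a : ↥(Dset d μ), dotR d (a : Rd d) (q - γq))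
        ≤ ((⨆ a : ↥(Dhat d μ μ0), dotR d (a : Rd d) γ) +
            ⨆ a : ↥(Dset d μ), dotR d (a : Rd d) (q - γ))) ∧
      (((⨆ a : ↥(Dhat d μ μ0), dotR d (a : Rd d) γ) +
          ⨆ a : ↥(Dset d μ), dotR d (a : Rd d) (q - γ))
        = ((⨆ a : ↥(Dhat d μ μ0), dotR d (a : Rd d) γq) +
            ⨆ a : ↥(Dset d μ), dotR d (a : Rd d) (q - γq))
        → γ = γq) := by
  obtain ⟨ha, hbd, -⟩ := hahat
  obtain ⟨hγ2, hD, hDh, -⟩ := hγq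
  have hs := fun a => (hH4 a).1
  have haD : ahat ∈ Dset d μ := ha.2
  have hbdd : ∀ s ⊆ Dset d μ, ∀ v : Rd d,
      BddAbove (Set.range fun a : ↥s => dotR d (a : Rd d) v) := by
    intro s hsub v
    obtain ⟨C, hC⟩ := bddAbove_dotR_Dset hμ.1 hs hH2.1 v
    exact ⟨C, by rintro _ ⟨a, rfl⟩; exact hC a (hsub a.2)⟩
  have hsplit : ∀ γ : Rd d, dotR d ahat γ + dotR d ahat (q - γ) = dotR d ahat q := fun γ => by
    rw [dotR_sub_right]; ring
  intro γ hγ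
  have h1 := le_ciSup (hbdd (Dhat d μ μ0) (fun a ha => ha.2) γ) ⟨ahat, ha⟩
  have h2 := le_ciSup (hbdd (Dset d μ) subset_rfl (q - γ)) ⟨ahat, haD⟩
  dsimp only at h1 h2
  rw [iSup_dotR_eq ha hDh, iSup_dotR_eq haD hD, hsplit]
  refine ⟨by linarith [hsplit γ], fun heq => ?_⟩
  have hcone : q - γ ∈ normalCone d (Dset d μ) ahat := mem_normalCone_iff.2 fun b hb =>
    (le_ciSup (hbdd (Dset d μ) subset_rfl (q - γ)) ⟨b, hb⟩).trans (by linarith [hsplit γ])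
  exact sub_right_injective (eq_of_mem_normalCone_Dset hμ hs hH3.1 hbd.1 hcone hD
    (by simp [hγ, hγ2]) (by simpa [hγ] using hq))

end ReflectedRW
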